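/- arXiv:2506.01323 — 4 statements merged into one kernel-verified Lean document; each statement's English description precedes it below -/
import Mathlib

section
/- Let ε > 0 and B > 0 be real numbers, N a positive integer, and σ a nonnegative real-valued function on a type ι. Define σ̃(t) = ⌊(N/(εB))·σ(t)⌋ for each t. Then for every Finset S of ι with cardinality at most N and Σ_{t ∈ S} σ̃(t) ≤ ⌊N/ε⌋, one has Σ_{t ∈ S} σ(t) ≤ (1 + ε)·B. -/
/-- FPTAS rounding-error bound: if `S` has at most `N` elements and the scaled measure
`σ̃(t) = ⌊(N/(εB))·σ(t)⌋` satisfies `Σ_{t∈S} σ̃(t) ≤ ⌊N/ε⌋`, then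
`Σ_{t∈S} σ(t) ≤ (1+ε)·B`. -/
theorem scaled_budget_implies_quality {ι : Type*} (ε B : ℝ) (hε : 0 < ε) (hB : 0 < B)
    (N : ℕ) (hN : 0 < N) (σ : ι → ℝ) (hσ : ∀ t, 0 ≤ σ t)
    (S : Finset ι) (hcard : S.card ≤ N)
    (hS : ∑ t ∈ S, ⌊((N : ℝ) / (ε * B)) * σ t⌋ ≤ ⌊(N : ℝ) / ε⌋) :
    ∑ t ∈ S, σ t ≤ (1 + ε) * B := by
  have hN' : (0 : ℝ) < N := Nat.cast_pos.mpr hN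
  have hc : 0 < (N : ℝ) / (ε * B) := by positivity
  have hfloor : ∑ t ∈ S, (⌊(N : ℝ) / (ε * B) * σ t⌋ : ℝ) ≤ N / ε := by
    exact_mod_cast Int.le_floor.mp hS
  have hcard' : (S.card : ℝ) ≤ N := Nat.cast_le.mpr hcard
  refine le_of_mul_le_mul_left ?_ hc
  calc (N : ℝ) / (ε * B) * ∑ t ∈ S, σ t
      = ∑ t ∈ S, (N : ℝ) / (ε * B) * σ t := Finset.mul_sum _ _ _
    _ ≤ ∑ t ∈ S, ((⌊(N : ℝ) / (ε * B) * σ t⌋ : ℝ) + 1) :=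
        Finset.sum_le_sum fun t _ => (Int.lt_floor_add_one _).le
    _ = ∑ t ∈ S, (⌊(N : ℝ) / (ε * B) * σ t⌋ : ℝ) + S.card := by
        simp [Finset.sum_add_distrib]
    _ ≤ N / ε + N := add_le_add hfloor hcard'
    _ = N / (ε * B) * ((1 + ε) * B) := by field_simp
end

section
/- Let ε > 0 and B > 0 be real numbers, N a positive integer, σ a nonnegative real-valued function and w any real-valued function on Finsets of a type ι. Define σ̃(t) = ⌊(N/(εB))·σ(t)⌋ and, for a Finset S, σ(S) = Σ_{t∈S} σ(t) and σ̃(S) = Σ_{t∈S} σ̃(t). Let F be a family of Finsets of ι, each of cardinality at most N. Suppose T̃ ∈ F satisfies σ̃(T̃) ≤ ⌊N/ε⌋ and w(T̃) ≤ w(T) for every T ∈ F with σ̃(T) ≤ ⌊N/ε⌋. Then for every T* ∈ F with σ(T*) ≤ B, one has w(T̃) ≤ w(T*) and σ(T̃) ≤ (1 + ε)·B. -/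
/-- Multiplying by `c` and rounding down termwise never exceeds the scaled sum. -/
theorem sum_floor_mul_le {ι : Type*} (s : Finset ι) (c : ℝ) (f : ι → ℝ) :
    ((∑ t ∈ s, ⌊c * f t⌋ : ℤ) : ℝ) ≤ c * ∑ t ∈ s, f t := by
  rw [Int.cast_sum, Finset.mul_sum]
  exact Finset.sum_le_sum fun t _ => Int.floor_le _

/-- Multiplying by `c` and rounding down termwise loses at most one unit per term. -/
theorem mul_sum_le_sum_floor_add_card {ι : Type*} (s : Finset ι) (c : ℝ) (f : ι → ℝ) :
    c * ∑ t ∈ s, f t ≤ ((∑ t ∈ s, ⌊c * f t⌋ : ℤ) : ℝ) + s.card := by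
  have h : ∑ t ∈ s, c * f t ≤ ∑ t ∈ s, ((⌊c * f t⌋ : ℝ) + 1) :=
    Finset.sum_le_sum fun t _ => (Int.lt_floor_add_one _).le
  simpa [Finset.mul_sum, Finset.sum_add_distrib] using h

/-- Abstract correctness of the FPTAS for bi-criteria triangulation: if `T̃ ∈ F`
is optimal (w.r.t. `w`) for the scaled budget `⌊N/ε⌋` with scaled measure
`σ̃(t) = ⌊(N/(εB))·σ(t)⌋`, then for any `T* ∈ F` feasible for the original budget `B`
(i.e. `σ(T*) ≤ B`) we have `w(T̃) ≤ w(T*)` and `σ(T̃) ≤ (1+ε)·B`. -/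
theorem bct_fptas_correct {ι : Type*} (ε B : ℝ) (hε : 0 < ε) (hB : 0 < B)
    (N : ℕ) (hN : 0 < N) (σ : ι → ℝ) (hσ : ∀ t, 0 ≤ σ t) (w : Finset ι → ℝ)
    (F : Set (Finset ι)) (hFcard : ∀ T ∈ F, T.card ≤ N)
    (Ttil : Finset ι) (hTtil : Ttil ∈ F)
    (hfeas : ∑ t ∈ Ttil, ⌊((N : ℝ) / (ε * B)) * σ t⌋ ≤ ⌊(N : ℝ) / ε⌋)
    (hopt : ∀ T ∈ F, ∑ t ∈ T, ⌊((N : ℝ) / (ε * B)) * σ t⌋ ≤ ⌊(N : ℝ) / ε⌋ →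
      w Ttil ≤ w T) :
    ∀ Tstar ∈ F, ∑ t ∈ Tstar, σ t ≤ B →
      w Ttil ≤ w Tstar ∧ ∑ t ∈ Ttil, σ t ≤ (1 + ε) * B := by
  have hN' : (0 : ℝ) < N := Nat.cast_pos.mpr hN
  have hc : 0 < (N : ℝ) / (ε * B) := by positivity
  intro Tstar hTstar hbudget
  constructor
  · refine hopt Tstar hTstar (Int.le_floor.mpr ?_)
    calc _ ≤ (N : ℝ) / (ε * B) * ∑ t ∈ Tstar, σ t := sum_floor_mul_le _ _ _
      _ ≤ (N : ℝ) / (ε * B) * B := by gcongr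
      _ = (N : ℝ) / ε := by field_simp
  · refine le_of_mul_le_mul_left ?_ hc
    have hcard : (Ttil.card : ℝ) ≤ N := Nat.cast_le.mpr (hFcard Ttil hTtil)
    calc _ ≤ _ := mul_sum_le_sum_floor_add_card _ _ _
      _ ≤ (N : ℝ) / ε + N := add_le_add (Int.le_floor.mp hfeas) hcard
      _ = (N : ℝ) / (ε * B) * ((1 + ε) * B) := by field_simp
end

section
/- Let β be a real number with arctan 4 < β ≤ 2·arctan 2, and set x = 2 − √(3 + 4·(cos β / sin β)). Then 0 < x ≤ 2 and arctan x + arctan(4 − x) = β. -/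
open Real

theorem sin_arctan_eq_mul_cos (x : ℝ) : sin (arctan x) = x * cos (arctan x) := by
  conv_rhs => rw [← tan_arctan x, arctan_tan (neg_pi_div_two_lt_arctan x) (arctan_lt_pi_div_two x)]
  exact (tan_mul_cos (cos_arctan_pos x).ne').symm

theorem sin_sub_arctan (β x : ℝ) :
    sin (β - arctan x) = cos (arctan x) * (sin β - x * cos β) := by
  rw [sin_sub, sin_arctan_eq_mul_cos]
  ring

theorem sin_sub_arctan_add_arctan (β x y : ℝ) :
    sin (β - (arctan x + arctan y)) =
      cos (arctan x) * cos (arctan y) * ((1 - x * y) * sin β - (x + y) * cos β) := by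
  rw [sin_sub, sin_add, cos_add, sin_arctan_eq_mul_cos, sin_arctan_eq_mul_cos]
  ring

/-- Proposition (p1-x-coord): for `arctan 4 < β ≤ 2·arctan 2`, setting
`x = 2 − √(3 + 4·cot β)` we have `0 < x ≤ 2` and `arctan x + arctan (4 − x) = β`. -/
theorem kite_angle_coordinate (β : ℝ) (h₁ : arctan 4 < β) (h₂ : β ≤ 2 * arctan 2) :
    0 < 2 - Real.sqrt (3 + 4 * (Real.cos β / Real.sin β)) ∧
    2 - Real.sqrt (3 + 4 * (Real.cos β / Real.sin β)) ≤ 2 ∧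
    arctan (2 - Real.sqrt (3 + 4 * (Real.cos β / Real.sin β))) +
      arctan (4 - (2 - Real.sqrt (3 + 4 * (Real.cos β / Real.sin β)))) = β := by
  have hpos : 0 < β := (arctan_pos.2 (by norm_num)).trans h₁
  have hπ : β < π := by linarith [arctan_lt_pi_div_two 2]
  have hsin : 0 < sin β := sin_pos_of_pos_of_lt_pi hpos hπ
  have hcot_lt : 4 * (cos β / sin β) < 1 := by
    have h : 0 < sin (β - arctan 4) :=
      sin_pos_of_pos_of_lt_pi (by linarith) (by linarith [arctan_pos.2 (four_pos (α := ℝ))])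
    rw [sin_sub_arctan] at h
    have := pos_of_mul_pos_right h (cos_arctan_pos 4).le
    rw [← mul_div_assoc, div_lt_one hsin]
    linarith
  have hcot_ge : 0 ≤ 3 + 4 * (cos β / sin β) := by
    have h : sin (β - (arctan 2 + arctan 2)) ≤ 0 :=
      sin_nonpos_of_nonpos_of_neg_pi_le (by linarith) (by linarith [arctan_lt_pi_div_two 2])
    rw [sin_sub_arctan_add_arctan] at h
    have := nonpos_of_mul_nonpos_right h (mul_pos (cos_arctan_pos 2) (cos_arctan_pos 2))
    have : 3 + 4 * (cos β / sin β) = (3 * sin β + 4 * cos β) / sin β := by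
      field_simp
    rw [this]
    exact div_nonneg (by linarith) hsin.le
  have hsq := sq_sqrt hcot_ge
  have hs := sqrt_nonneg (3 + 4 * (cos β / sin β))
  have hs_lt : √(3 + 4 * (cos β / sin β)) < 2 := by
    rw [sqrt_lt' two_pos]
    linarith
  set s := √(3 + 4 * (cos β / sin β))
  refine ⟨by linarith, by linarith, ?_⟩
  have hx : 0 < arctan (2 - s) := arctan_pos.2 (by linarith)
  have hy : 0 < arctan (4 - (2 - s)) := arctan_pos.2 (by linarith)
  have hzero : sin (β - (arctan (2 - s) + arctan (4 - (2 - s)))) = 0 := by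
    have hcot : cos β / sin β * sin β = cos β := div_mul_cancel₀ _ hsin.ne'
    rw [sin_sub_arctan_add_arctan]
    refine mul_eq_zero_of_right _ ?_
    linear_combination sin β * hsq + 4 * hcot
  have := (sin_eq_zero_iff_of_lt_of_lt
    (by linarith [arctan_lt_pi_div_two (2 - s), arctan_lt_pi_div_two (4 - (2 - s))])
    (by linarith)).1 hzero
  linarith
end

section
/- Fix an integer n ≥ 4 and label the vertices of a convex n-gon 0, 1, …, n−1 in cyclic order. A diagonal is an unordered pair {i, j} with 0 ≤ i < j ≤ n−1, j − i ≥ 2, and (i, j) ≠ (0, n−1). Two diagonals {a, b} (a < b) and {c, d} (c < d) cross if and only if a < c < b < d or c < a < d < b. A triangulation is a set of n−3 pairwise non-crossing diagonals. Then for every integer k with 1 ≤ k and 2k ≤ n, there exist k triangulations T₁, …, T_k that are pairwise disjoint, i.e., T_i ∩ T_j = ∅ for all i ≠ j. -/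
/-- A diagonal of a convex `n`-gon with vertices `0, …, n−1`: an (ordered
representative of an) unordered pair `{i, j}` with `i < j ≤ n−1`, `j − i ≥ 2`,
and `(i, j) ≠ (0, n−1)`. -/
def IsDiagonal (n : ℕ) (d : ℕ × ℕ) : Prop :=
  d.1 + 2 ≤ d.2 ∧ d.2 ≤ n - 1 ∧ ¬(d.1 = 0 ∧ d.2 = n - 1)

/-- Two diagonals `{a,b}` (`a < b`) and `{c,d}` (`c < d`) cross iff
`a < c < b < d` or `c < a < d < b`. -/
def Crossing (d e : ℕ × ℕ) : Prop :=
  (d.1 < e.1 ∧ e.1 < d.2 ∧ d.2 < e.2) ∨ (e.1 < d.1 ∧ d.1 < e.2 ∧ e.2 < d.2)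

/-- A triangulation of the convex `n`-gon: a set of `n − 3` pairwise
non-crossing diagonals. -/
def IsTriangulation (n : ℕ) (T : Finset (ℕ × ℕ)) : Prop :=
  T.card = n - 3 ∧ (∀ d ∈ T, IsDiagonal n d) ∧
    ∀ d ∈ T, ∀ e ∈ T, d ≠ e → ¬Crossing d e

/-- The `m`-th edge of the zigzag path `i, i + 1, i - 1, i + 2, …` (vertices mod `n`), with its
endpoints in increasing order. -/
def zigzagEdge (n i m : ℕ) : ℕ × ℕ :=
  if (m + 1) / 2 ≤ i then (i - (m + 1) / 2, i + 1 + m / 2)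
  else (i + 1 + m / 2, i + n - (m + 1) / 2)

/-- The zigzag triangulation with the side `{i, i + 1}` as its initial edge. -/
def zigzag (n i : ℕ) : Finset (ℕ × ℕ) :=
  (Finset.Icc 1 (n - 3)).image (zigzagEdge n i)

theorem zigzagEdge_injOn (n i : ℕ) (hn : 3 ≤ n) :
    Set.InjOn (zigzagEdge n i) (Finset.Icc 1 (n - 3)) := by
  intro m hm m' hm' h
  simp only [Finset.coe_Icc, Set.mem_Icc] at hm hm'
  simp only [zigzagEdge] at h
  split_ifs at h <;> rw [Prod.mk.injEq] at h <;> omega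

theorem isDiagonal_of_mem_zigzag {n i : ℕ} (hi : 2 * (i + 1) ≤ n) {d : ℕ × ℕ}
    (hd : d ∈ zigzag n i) : IsDiagonal n d := by
  simp only [zigzag, Finset.mem_image, Finset.mem_Icc] at hd
  obtain ⟨m, hm, rfl⟩ := hd
  simp only [IsDiagonal, zigzagEdge]
  split_ifs <;> dsimp only <;> omega

/-- Endpoint sums of zigzag edges are congruent to `2 * i` or `2 * i + 1` modulo `n`. -/
theorem sum_of_mem_zigzag {n i : ℕ} {d : ℕ × ℕ} (hd : d ∈ zigzag n i) :
    d.1 + d.2 = 2 * i ∨ d.1 + d.2 = 2 * i + 1 ∨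
      d.1 + d.2 = 2 * i + n ∨ d.1 + d.2 = 2 * i + 1 + n := by
  simp only [zigzag, Finset.mem_image, Finset.mem_Icc] at hd
  obtain ⟨m, hm, rfl⟩ := hd
  simp only [zigzagEdge]
  split_ifs <;> dsimp only <;> omega

theorem isTriangulation_zigzag {n i : ℕ} (hn : 3 ≤ n) (hi : 2 * (i + 1) ≤ n) :
    IsTriangulation n (zigzag n i) := by
  refine ⟨?_, fun d hd => isDiagonal_of_mem_zigzag hi hd, fun d hd e he _ => ?_⟩
  · rw [zigzag, Finset.card_image_of_injOn (zigzagEdge_injOn n i hn)]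
    simp
  · have hd' := isDiagonal_of_mem_zigzag hi hd
    have he' := isDiagonal_of_mem_zigzag hi he
    have hds := sum_of_mem_zigzag hd
    have hes := sum_of_mem_zigzag he
    simp only [IsDiagonal] at hd' he'
    simp only [Crossing]
    omega

theorem disjoint_zigzag {n i j : ℕ} (hi : 2 * (i + 1) ≤ n) (hj : 2 * (j + 1) ≤ n)
    (hij : i ≠ j) : Disjoint (zigzag n i) (zigzag n j) := by
  refine Finset.disjoint_left.mpr fun d hd he => ?_
  have hds := sum_of_mem_zigzag hd
  have hes := sum_of_mem_zigzag he
  omega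

/-- Disjoint-triangulations lemma: for every `n ≥ 4` and `1 ≤ k` with `2k ≤ n`,
a convex `n`-gon admits `k` pairwise disjoint triangulations. -/
theorem exists_disjoint_triangulations (n k : ℕ) (hn : 4 ≤ n) (hk : 1 ≤ k)
    (hkn : 2 * k ≤ n) :
    ∃ Ts : Fin k → Finset (ℕ × ℕ),
      (∀ i, IsTriangulation n (Ts i)) ∧
      ∀ i j, i ≠ j → Ts i ∩ Ts j = ∅ := by
  refine ⟨fun i => zigzag n i, fun i => isTriangulation_zigzag (by omega) (by omega),
    fun i j hij => Finset.disjoint_iff_inter_eq_empty.mp ?_⟩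
  exact disjoint_zigzag (by omega) (by omega) (Fin.val_ne_of_ne hij)
end
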